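/- arXiv:1402.4568 — 2 statements merged into one kernel-verified Lean document; each statement's English description precedes it below -/
import Mathlib

section
/- Suppose every triple product φ_i φ_j φ_k is μ-integrable, with triple-product coefficients e_{ijk} = ∫ φ_i φ_j φ_k dμ, and the φ_i are orthogonal: ∫ φ_i φ_j dμ = h_i² δ_{ij}, h_i > 0. Let A(Δ) = Σ_i A_i φ_i(Δ), B(Δ) = Σ_i B_i φ_i(Δ) with A_i ∈ ℝ^{n×n}, B_i ∈ ℝ^{n×m}, and for each k let x(k,Δ) = Σ_j x_j(k) φ_j(Δ), u(k,Δ) = Σ_j u_j(k) φ_j(Δ) (all sums over 0,…,p). If the stochastic recursion x(k+1,Δ) = A(Δ)x(k,Δ) + B(Δ)u(k,Δ) holds for μ-almost every Δ, then the gPC coefficients obey the deterministic linear recursion: for every k and every index j, h_j² x_j(k+1) = Σ_{i=0}^{p} Σ_{l=0}^{p} e_{ilj} ( A_i x_l(k) + B_i u_l(k) ). -/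
open MeasureTheory Matrix

/-- Expansion of `A(c) x(c) + B(c) u(c)` as a double sum, where all four factors are linear
combinations with the same scalar weights `c`. -/
theorem sum_smul_mulVec_add_sum_smul_mulVec {ι α β γ R : Type*} [Fintype ι] [Fintype β]
    [Fintype γ] [CommSemiring R] (c : ι → R) (A : ι → Matrix α β R) (B : ι → Matrix α γ R)
    (x : ι → β → R) (u : ι → γ → R) :
    (∑ i, c i • A i) *ᵥ (∑ l, c l • x l) + (∑ i, c i • B i) *ᵥ (∑ l, c l • u l) =
      ∑ i, ∑ l, (c i * c l) • (A i *ᵥ x l + B i *ᵥ u l) := by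
  simp only [sum_mulVec, mulVec_sum, smul_mulVec, mulVec_smul, smul_add,
    Finset.sum_add_distrib, mul_smul, Finset.smul_sum]
  congr 1 <;>
  · rw [Finset.sum_comm]
    exact Finset.sum_congr rfl fun i _ => Finset.sum_congr rfl fun l _ => smul_comm _ _ _

/-- If the stochastic recursion `x(k+1,Δ) = A(Δ)x(k,Δ) + B(Δ)u(k,Δ)`
holds μ-a.e., then the gPC coefficients obey the deterministic linear recursion
`h_j² x_j(k+1) = Σᵢ Σₗ e_{ilj} (Aᵢ xₗ(k) + Bᵢ uₗ(k))`. -/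
theorem gpc_linear_recursion
    (μ : Measure ℝ) [IsProbabilityMeasure μ] (p n m : ℕ)
    (φ : Fin (p + 1) → ℝ → ℝ) (h : Fin (p + 1) → ℝ)
    (hmeas : ∀ i, Measurable (φ i))
    (hpos : ∀ i, 0 < h i)
    (hint : ∀ i j, Integrable (fun t => φ i t * φ j t) μ)
    (horth : ∀ i j, ∫ t, φ i t * φ j t ∂μ = if i = j then (h i) ^ 2 else 0)
    (htriple : ∀ i j k, Integrable (fun t => φ i t * φ j t * φ k t) μ)
    (A : Fin (p + 1) → Matrix (Fin n) (Fin n) ℝ)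
    (B : Fin (p + 1) → Matrix (Fin n) (Fin m) ℝ)
    (x : ℕ → Fin (p + 1) → Fin n → ℝ)
    (u : ℕ → Fin (p + 1) → Fin m → ℝ)
    (hdyn : ∀ k, ∀ᵐ t ∂μ,
      (∑ j, φ j t • x (k + 1) j) =
        (∑ i, φ i t • A i) *ᵥ (∑ j, φ j t • x k j) +
        (∑ i, φ i t • B i) *ᵥ (∑ j, φ j t • u k j)) :
    ∀ k, ∀ j : Fin (p + 1),
      (h j) ^ 2 • x (k + 1) j =
        ∑ i, ∑ l, (∫ t, φ i t * φ l t * φ j t ∂μ) •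
          ((A i) *ᵥ x k l + (B i) *ᵥ u k l) := by
  intro k j
  ext r
  have key : ∫ t, ∑ l, φ l t * φ j t * x (k + 1) l r ∂μ =
      ∫ t, ∑ i, ∑ l, φ i t * φ l t * φ j t * (A i *ᵥ x k l + B i *ᵥ u k l) r ∂μ := by
    refine integral_congr_ae ?_
    filter_upwards [hdyn k] with t ht
    have hr := congrFun (ht.trans (sum_smul_mulVec_add_sum_smul_mulVec
      (fun i => φ i t) A B (x k) (u k))) r
    simp only [Finset.sum_apply, Pi.smul_apply, smul_eq_mul] at hr
    calc ∑ l, φ l t * φ j t * x (k + 1) l r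
        = (∑ l, φ l t * x (k + 1) l r) * φ j t := by
          rw [Finset.sum_mul]
          exact Finset.sum_congr rfl fun l _ => by ring
      _ = _ := by
          rw [hr]
          simp only [Finset.sum_mul]
          exact Finset.sum_congr rfl fun i _ => Finset.sum_congr rfl fun l _ => by ring
  rw [integral_finsetSum _ fun l _ => (hint l j).mul_const _,
    integral_finsetSum _ fun i _ =>
      integrable_finsetSum _ fun l _ => (htriple i l j).mul_const _] at key
  simp only [integral_mul_const, horth, ite_mul, zero_mul, Finset.sum_ite_eq',
    Finset.mem_univ, if_true] at key
  simp only [Finset.sum_apply, Pi.smul_apply, smul_eq_mul]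
  rw [key]
  refine Finset.sum_congr rfl fun i _ => ?_
  rw [integral_finsetSum _ fun l _ => (htriple i l j).mul_const _]
  simp only [integral_mul_const]
end

section
/- Suppose every triple product φ_i φ_j φ_k is μ-integrable, with triple-product coefficients e_{ijk} = ∫ φ_i φ_j φ_k dμ, the φ_i are orthogonal (∫ φ_i φ_j dμ = h_i² δ_{ij}, h_i > 0), and φ_0 ≡ 1. Let A(Δ) = Σ_i A_i φ_i(Δ), B(Δ) = Σ_i B_i φ_i(Δ), and for each k let x(k,Δ) = Σ_j x_j(k) φ_j(Δ). Suppose the closed-loop control u(k,Δ) = ū(k) + K(k)(x(k,Δ) − E[x(k,Δ)]) is applied, with ū(k) ∈ ℝ^m, K(k) ∈ ℝ^{m×n}, and the recursion x(k+1,Δ) = A(Δ)x(k,Δ) + B(Δ)u(k,Δ) holds for μ-almost every Δ. Then for every k and every index j: h_j² x_j(k+1) = Σ_{i=0}^{p} Σ_{l=0}^{p} e_{ilj} A_i x_l(k) + Σ_{i=0}^{p} e_{i0j} B_i ū(k) + Σ_{i=0}^{p} Σ_{l=1}^{p} e_{ilj} B_i K(k) x_l(k); i.e., the gPC coefficient vector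 evolves by the deterministic closed-loop dynamics X(k+1) = (A + B(M ⊗ K(k)))X(k) + B Ū(k) of the paper. -/
open MeasureTheory Matrix

/-- The mean of a gPC expansion is its zeroth coefficient. -/
theorem integral_gpc_expansion {E : Type*} [NormedAddCommGroup E] [NormedSpace ℝ E]
    [CompleteSpace E] (μ : Measure ℝ) [IsProbabilityMeasure μ] (p : ℕ)
    (φ : Fin (p + 1) → ℝ → ℝ) (h : Fin (p + 1) → ℝ)
    (hint : ∀ i j, Integrable (fun t => φ i t * φ j t) μ)
    (horth : ∀ i j, ∫ t, φ i t * φ j t ∂μ = if i = j then (h i) ^ 2 else 0)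
    (hφ0 : ∀ t, φ 0 t = 1) (x : Fin (p + 1) → E) :
    ∫ s, (∑ j, φ j s • x j) ∂μ = x 0 := by
  have hφ : ∀ j, Integrable (φ j) μ := fun j => by simpa [hφ0] using hint j 0
  rw [integral_finsetSum _ fun j _ => (hφ j).smul_const (x j)]
  simp_rw [integral_smul_const]
  rw [Finset.sum_eq_single 0]
  · simp [hφ0]
  · intro j _ hj
    have := horth j 0
    simp only [hφ0, mul_one, if_neg hj] at this
    simp [this]
  · simp

/-- Expansion of the product of a linear combination of matrices with a linear combination of
vectors, scaled by `c`. -/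
theorem smul_sum_smul_mulVec_sum_smul {ι κ α β : Type*} [Fintype α] [Fintype β]
    (s : Finset ι) (r : Finset κ) (c : ℝ) (a : ι → ℝ) (b : κ → ℝ)
    (M : ι → Matrix α β ℝ) (v : κ → β → ℝ) :
    c • ((∑ i ∈ s, a i • M i) *ᵥ (∑ l ∈ r, b l • v l)) =
      ∑ i ∈ s, ∑ l ∈ r, (a i * b l * c) • (M i *ᵥ v l) := by
  simp_rw [Matrix.sum_mulVec, Matrix.mulVec_sum, Finset.smul_sum, Matrix.smul_mulVec,
    Matrix.mulVec_smul, smul_smul]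
  refine Finset.sum_congr rfl fun i _ => Finset.sum_congr rfl fun l _ => ?_
  congr 1
  ring

/-- Under the closed-loop control
`u(k,Δ) = ū(k) + K(k)(x(k,Δ) − E[x(k,Δ)])`, if the stochastic recursion
`x(k+1,Δ) = A(Δ)x(k,Δ) + B(Δ)u(k,Δ)` holds μ-a.e. then the gPC coefficients
obey the deterministic closed-loop dynamics
`h_j² x_j(k+1) = Σᵢ Σₗ e_{ilj} Aᵢ xₗ(k) + Σᵢ e_{i0j} Bᵢ ū(k)
               + Σᵢ Σ_{l≥1} e_{ilj} Bᵢ K(k) xₗ(k)`. -/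
theorem gpc_closed_loop_dynamics
    (μ : Measure ℝ) [IsProbabilityMeasure μ] (p n m : ℕ)
    (φ : Fin (p + 1) → ℝ → ℝ) (h : Fin (p + 1) → ℝ)
    (hmeas : ∀ i, Measurable (φ i))
    (hpos : ∀ i, 0 < h i)
    (hint : ∀ i j, Integrable (fun t => φ i t * φ j t) μ)
    (horth : ∀ i j, ∫ t, φ i t * φ j t ∂μ = if i = j then (h i) ^ 2 else 0)
    (htriple : ∀ i j k, Integrable (fun t => φ i t * φ j t * φ k t) μ)
    (hφ0 : ∀ t, φ 0 t = 1)
    (A : Fin (p + 1) → Matrix (Fin n) (Fin n) ℝ)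
    (B : Fin (p + 1) → Matrix (Fin n) (Fin m) ℝ)
    (x : ℕ → Fin (p + 1) → Fin n → ℝ)
    (ubar : ℕ → Fin m → ℝ) (K : ℕ → Matrix (Fin m) (Fin n) ℝ)
    (hdyn : ∀ k, ∀ᵐ t ∂μ,
      (∑ j, φ j t • x (k + 1) j) =
        (∑ i, φ i t • A i) *ᵥ (∑ j, φ j t • x k j) +
        (∑ i, φ i t • B i) *ᵥ
          (ubar k + (K k) *ᵥ
            ((∑ j, φ j t • x k j) - ∫ s, (∑ j, φ j s • x k j) ∂μ))) :
    ∀ k, ∀ j : Fin (p + 1),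
      (h j) ^ 2 • x (k + 1) j =
        (∑ i, ∑ l, (∫ t, φ i t * φ l t * φ j t ∂μ) • ((A i) *ᵥ x k l)) +
        (∑ i, (∫ t, φ i t * φ 0 t * φ j t ∂μ) • ((B i) *ᵥ ubar k)) +
        (∑ i, ∑ l ∈ Finset.univ.erase 0,
          (∫ t, φ i t * φ l t * φ j t ∂μ) •
            ((B i) *ᵥ ((K k) *ᵥ x k l))) := by
  intro k j
  have hproj : ∀ᵐ t ∂μ, ∑ l, (φ l t * φ j t) • x (k + 1) l =
      (∑ i, ∑ l, (φ i t * φ l t * φ j t) • (A i *ᵥ x k l)) +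
      (∑ i, (φ i t * φ 0 t * φ j t) • (B i *ᵥ ubar k)) +
      (∑ i, ∑ l ∈ Finset.univ.erase 0, (φ i t * φ l t * φ j t) • (B i *ᵥ (K k *ᵥ x k l))) := by
    filter_upwards [hdyn k] with t ht
    rw [integral_gpc_expansion μ p φ h hint horth hφ0] at ht
    have hfluct : (∑ l, φ l t • x k l) - x k 0 = ∑ l ∈ Finset.univ.erase 0, φ l t • x k l := by
      rw [← Finset.add_sum_erase _ _ (Finset.mem_univ (0 : Fin (p + 1)))]
      simp [hφ0]
    have hB := smul_sum_smul_mulVec_sum_smul Finset.univ {(0 : Fin (p + 1))} (φ j t)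
      (fun i => φ i t) (fun l => φ l t) B (fun _ => ubar k)
    simp only [Finset.sum_singleton] at hB
    have hKsum : K k *ᵥ (∑ l ∈ Finset.univ.erase 0, φ l t • x k l) =
        ∑ l ∈ Finset.univ.erase 0, φ l t • (K k *ᵥ x k l) := by
      simp_rw [Matrix.mulVec_sum, Matrix.mulVec_smul]
    have hlhs : ∑ l, (φ l t * φ j t) • x (k + 1) l = φ j t • ∑ l, φ l t • x (k + 1) l := by
      simp_rw [Finset.smul_sum, smul_smul, mul_comm]
    rw [hlhs, ht, hfluct, Matrix.mulVec_add, smul_add, smul_add, hKsum]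
    rw [smul_sum_smul_mulVec_sum_smul, smul_sum_smul_mulVec_sum_smul, ← hB, hφ0, one_smul,
      add_assoc]
  have hA : ∀ i l, Integrable (fun t => (φ i t * φ l t * φ j t) • (A i *ᵥ x k l)) μ :=
    fun i l => (htriple i l j).smul_const _
  have hU : ∀ i, Integrable (fun t => (φ i t * φ 0 t * φ j t) • (B i *ᵥ ubar k)) μ :=
    fun i => (htriple i 0 j).smul_const _
  have hK : ∀ i l, Integrable (fun t => (φ i t * φ l t * φ j t) • (B i *ᵥ (K k *ᵥ x k l))) μ :=
    fun i l => (htriple i l j).smul_const _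
  have hA' := fun i => integrable_finsetSum Finset.univ fun l _ => hA i l
  have hK' := fun i => integrable_finsetSum (Finset.univ.erase 0) fun l _ => hK i l
  have hA'' := integrable_finsetSum Finset.univ fun i _ => hA' i
  have hU' := integrable_finsetSum Finset.univ fun i _ => hU i
  have hK'' := integrable_finsetSum Finset.univ fun i _ => hK' i
  have key := integral_congr_ae hproj
  rw [integral_finsetSum _ fun l _ => (hint l j).smul_const _,
    integral_add (by exact hA''.add hU') hK'', integral_add hA'' hU',
    integral_finsetSum _ fun i _ => hA' i, integral_finsetSum _ fun i _ => hU i,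
    integral_finsetSum _ fun i _ => hK' i] at key
  simp_rw [integral_finsetSum _ fun l _ => hA _ l, integral_finsetSum _ fun l _ => hK _ l,
    integral_smul_const, horth] at key
  simpa using key
end
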